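/- arXiv:quant-ph/0611001 — 2 statements merged into one kernel-verified Lean document; each statement's English description precedes it below -/
import Mathlib

section
/- Let A₁, A₂, B₁, B₂, C₁, C₂ be Hermitian operators with operator norm at most 1 on finite-dimensional Hilbert spaces H_A, H_B, H_C respectively, and let ρ be a density operator on H_A ⊗ H_B ⊗ H_C. Define ⟨𝓑_AB⟩ = tr(ρ · (A₁⊗(B₁+B₂)⊗1 + A₂⊗(B₁−B₂)⊗1)) and ⟨𝓑_AC⟩ = tr(ρ · (A₁⊗1⊗(C₁+C₂) + A₂⊗1⊗(C₁−C₂))). Then ⟨𝓑_AB⟩² + ⟨𝓑_AC⟩² ≤ 8. -/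
open Matrix Kronecker ComplexOrder

open scoped MatrixOrder in
/-- The operator bound behind CHSH monogamy: the combination of the two CHSH operators with weights
`x` and `y` has square at most `8 * (x ^ 2 + y ^ 2)`. -/
theorem posSemidef_sub_chsh_combination_sq {n : Type*} [Fintype n] [DecidableEq n]
    {a₁ a₂ b₁ b₂ c₁ c₂ : Matrix n n ℂ} (x y : ℝ)
    (ha₁ : star a₁ = a₁) (ha₂ : star a₂ = a₂) (hb₁ : star b₁ = b₁) (hb₂ : star b₂ = b₂)
    (hc₁ : star c₁ = c₁) (hc₂ : star c₂ = c₂)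
    (ha₁n : (1 - a₁ * a₁).PosSemidef) (ha₂n : (1 - a₂ * a₂).PosSemidef)
    (hb₁n : (1 - b₁ * b₁).PosSemidef) (hb₂n : (1 - b₂ * b₂).PosSemidef)
    (hc₁n : (1 - c₁ * c₁).PosSemidef) (hc₂n : (1 - c₂ * c₂).PosSemidef)
    (ha₁b₁ : Commute a₁ b₁) (ha₁b₂ : Commute a₁ b₂)
    (ha₂b₁ : Commute a₂ b₁) (ha₂b₂ : Commute a₂ b₂)
    (ha₁c₁ : Commute a₁ c₁) (ha₁c₂ : Commute a₁ c₂)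
    (ha₂c₁ : Commute a₂ c₁) (ha₂c₂ : Commute a₂ c₂)
    (hb₁c₁ : Commute b₁ c₁) (hb₁c₂ : Commute b₁ c₂)
    (hb₂c₁ : Commute b₂ c₁) (hb₂c₂ : Commute b₂ c₂) :
    ((8 * (x ^ 2 + y ^ 2)) • (1 : Matrix n n ℂ) -
      (x • (a₁ * (b₁ + b₂) + a₂ * (b₁ - b₂)) +
        y • (a₁ * (c₁ + c₂) + a₂ * (c₁ - c₂))) ^ 2).PosSemidef := by
  rw [← nonneg_iff_posSemidef] at *
  have conj {p z : Matrix n n ℂ} (hp : 0 ≤ p) (hz : star z = z) : 0 ≤ z * p * z := by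
    simpa only [hz] using star_left_conjugate_nonneg hp z
  have compl {p q : Matrix n n ℂ} (h : Commute p q) : Commute (1 - p * p) (1 - q * q) :=
    have h' := (h.mul_left h).mul_right (h.mul_left h)
    (Commute.one_left _).sub_left ((Commute.one_right _).sub_right h')
  have prod {p q : Matrix n n ℂ} (hp : 0 ≤ 1 - p * p) (hq : 0 ≤ 1 - q * q) (h : Commute p q) :
      0 ≤ (1 - p * p) * (1 - q * q) := (compl h).mul_nonneg hp hq
  have scale (r : ℝ) {p : Matrix n n ℂ} (hp : 0 ≤ p) : 0 ≤ r ^ 2 • p :=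
    smul_nonneg (sq_nonneg r) hp
  have hsq : 0 ≤ (x • ((a₁ + a₂) * b₁) + y • ((a₁ - a₂) * c₂)
      - x • ((a₁ - a₂) * b₂) - y • ((a₁ + a₂) * c₁)) ^ 2 := by
    rw [sq]
    refine IsSelfAdjoint.mul_self_nonneg ?_
    simp only [IsSelfAdjoint, star_sub, star_add, star_smul, star_mul, ha₁, ha₂, hb₁, hb₂,
      hc₁, hc₂, star_trivial, add_mul, sub_mul,
      ha₁b₁.symm.eq, ha₁b₂.symm.eq, ha₂b₁.symm.eq, ha₂b₂.symm.eq,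
      ha₁c₁.symm.eq, ha₁c₂.symm.eq, ha₂c₁.symm.eq, ha₂c₂.symm.eq]
  have hS : star (a₁ + a₂) = a₁ + a₂ := by rw [star_add, ha₁, ha₂]
  have hD : star (a₁ - a₂) = a₁ - a₂ := by rw [star_sub, ha₁, ha₂]
  have hZ (r s : ℝ) {p q : Matrix n n ℂ} (hp : star p = p) (hq : star q = q) :
      star (r • p + s • q) = r • p + s • q := by simp [hp, hq]
  have hs := add_nonneg
    (add_nonneg (scale x (conj hb₁n hS)) (scale y (conj hc₂n hD)))
    (add_nonneg (scale x (conj hb₂n hD)) (scale y (conj hc₁n hS)))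
  have h₁ := add_nonneg (add_nonneg (conj ha₁n (hZ x y hb₁ hc₂)) (conj ha₁n (hZ x y hb₂ hc₁)))
    (add_nonneg
      (add_nonneg (scale x (prod ha₁n hb₁n ha₁b₁)) (scale y (prod ha₁n hc₂n ha₁c₂)))
      (add_nonneg (scale x (prod ha₁n hb₂n ha₁b₂)) (scale y (prod ha₁n hc₁n ha₁c₁))))
  have h₂ := add_nonneg
    (add_nonneg (conj ha₂n (hZ x (-y) hb₁ hc₂)) (conj ha₂n (hZ x (-y) hb₂ hc₁)))
    (add_nonneg
      (add_nonneg (scale x (prod ha₂n hb₁n ha₂b₁)) (scale y (prod ha₂n hc₂n ha₂c₂)))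
      (add_nonneg (scale x (prod ha₂n hb₂n ha₂b₂)) (scale y (prod ha₂n hc₁n ha₂c₁))))
  have h := add_nonneg hs (add_nonneg h₁ h₂)
  convert add_nonneg hsq (add_nonneg h h) using 1
  simp only [sq, mul_add, mul_sub, add_mul, sub_mul, mul_assoc, smul_mul_assoc, mul_smul_comm,
    mul_one, one_mul, ha₁b₁.symm.eq, ha₁b₂.symm.eq, ha₂b₁.symm.eq, ha₂b₂.symm.eq,
    ha₁c₁.symm.eq, ha₁c₂.symm.eq, ha₂c₁.symm.eq, ha₂c₂.symm.eq,
    hb₁c₁.symm.eq, hb₁c₂.symm.eq, hb₂c₁.symm.eq, hb₂c₂.symm.eq,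
    ha₁b₁.symm.left_comm, ha₁b₂.symm.left_comm, ha₂b₁.symm.left_comm, ha₂b₂.symm.left_comm,
    ha₁c₁.symm.left_comm, ha₁c₂.symm.left_comm, ha₂c₁.symm.left_comm, ha₂c₂.symm.left_comm]
  module

theorem Matrix.sub_kronecker {R l m n p : Type*} [NonUnitalNonAssocRing R]
    (A₁ A₂ : Matrix l m R) (B : Matrix n p R) : (A₁ - A₂) ⊗ₖ B = A₁ ⊗ₖ B - A₂ ⊗ₖ B := by
  ext
  simp [sub_mul]

theorem Matrix.kronecker_sub {R l m n p : Type*} [NonUnitalNonAssocRing R]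
    (A : Matrix l m R) (B₁ B₂ : Matrix n p R) : A ⊗ₖ (B₁ - B₂) = A ⊗ₖ B₁ - A ⊗ₖ B₂ := by
  ext
  simp [mul_sub]

open scoped MatrixOrder in
/-- The trace of the product of two positive semidefinite matrices has nonnegative real part. -/
theorem Matrix.PosSemidef.re_trace_mul_nonneg {n : Type*} [Fintype n]
    {ρ X : Matrix n n ℂ} (hρ : ρ.PosSemidef) (hX : X.PosSemidef) : 0 ≤ (ρ * X).trace.re := by
  classical
  obtain ⟨Y, rfl⟩ := CStarAlgebra.nonneg_iff_eq_star_mul_self.mp hX.nonneg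
  rw [← Matrix.mul_assoc, trace_mul_comm, ← Matrix.mul_assoc]
  exact (Complex.le_def.mp (hρ.mul_mul_conjTranspose_same Y).trace_nonneg).1

open scoped MatrixOrder in
/-- If an observable `M` satisfies `M ^ 2 ≤ r • 1`, then its squared expectation is at most `r`. -/
theorem Matrix.PosSemidef.sq_re_trace_mul_le {n : Type*} [Fintype n] [DecidableEq n]
    {ρ M : Matrix n n ℂ} {r : ℝ} (hρ : ρ.PosSemidef) (hρtr : ρ.trace = 1)
    (hM : IsSelfAdjoint M) (h : (r • (1 : Matrix n n ℂ) - M ^ 2).PosSemidef) :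
    (ρ * M).trace.re ^ 2 ≤ r := by
  set m := (ρ * M).trace.re with hm
  have hvar : 0 ≤ (M - m • (1 : Matrix n n ℂ)) * (M - m • (1 : Matrix n n ℂ)) :=
    (hM.sub ((IsSelfAdjoint.all m).smul (.one _))).mul_self_nonneg
  have h₁ := hρ.re_trace_mul_nonneg (nonneg_iff_posSemidef.mp hvar)
  have h₂ := hρ.re_trace_mul_nonneg h
  simp [sq, mul_sub, sub_mul, hρtr, ← hm] at h₁ h₂
  nlinarith

/-- Monogamy of CHSH correlations: ⟨B_AB⟩² + ⟨B_AC⟩² ≤ 8. -/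
theorem chsh_monogamy {a b c : ℕ}
    (A₁ A₂ : Matrix (Fin a) (Fin a) ℂ) (B₁ B₂ : Matrix (Fin b) (Fin b) ℂ)
    (C₁ C₂ : Matrix (Fin c) (Fin c) ℂ)
    (hA₁ : A₁.IsHermitian) (hA₂ : A₂.IsHermitian)
    (hB₁ : B₁.IsHermitian) (hB₂ : B₂.IsHermitian)
    (hC₁ : C₁.IsHermitian) (hC₂ : C₂.IsHermitian)
    (hA₁n : (1 - A₁ * A₁).PosSemidef) (hA₂n : (1 - A₂ * A₂).PosSemidef)
    (hB₁n : (1 - B₁ * B₁).PosSemidef) (hB₂n : (1 - B₂ * B₂).PosSemidef)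
    (hC₁n : (1 - C₁ * C₁).PosSemidef) (hC₂n : (1 - C₂ * C₂).PosSemidef)
    (ρ : Matrix (Fin a × Fin b × Fin c) (Fin a × Fin b × Fin c) ℂ)
    (hρ : ρ.PosSemidef) (hρtr : ρ.trace = 1) :
    ((ρ * (A₁ ⊗ₖ ((B₁ + B₂) ⊗ₖ (1 : Matrix (Fin c) (Fin c) ℂ)) +
           A₂ ⊗ₖ ((B₁ - B₂) ⊗ₖ (1 : Matrix (Fin c) (Fin c) ℂ)))).trace.re) ^ 2 +
    ((ρ * (A₁ ⊗ₖ ((1 : Matrix (Fin b) (Fin b) ℂ) ⊗ₖ (C₁ + C₂)) +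
           A₂ ⊗ₖ ((1 : Matrix (Fin b) (Fin b) ℂ) ⊗ₖ (C₁ - C₂)))).trace.re) ^ 2 ≤ 8 := by
  let U (A : Matrix (Fin a) (Fin a) ℂ) : Matrix (Fin a × Fin b × Fin c) (Fin a × Fin b × Fin c) ℂ :=
    A ⊗ₖ ((1 : Matrix (Fin b) (Fin b) ℂ) ⊗ₖ (1 : Matrix (Fin c) (Fin c) ℂ))
  let V (B : Matrix (Fin b) (Fin b) ℂ) : Matrix (Fin a × Fin b × Fin c) (Fin a × Fin b × Fin c) ℂ :=
    (1 : Matrix (Fin a) (Fin a) ℂ) ⊗ₖ (B ⊗ₖ (1 : Matrix (Fin c) (Fin c) ℂ))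
  let W (C : Matrix (Fin c) (Fin c) ℂ) : Matrix (Fin a × Fin b × Fin c) (Fin a × Fin b × Fin c) ℂ :=
    (1 : Matrix (Fin a) (Fin a) ℂ) ⊗ₖ ((1 : Matrix (Fin b) (Fin b) ℂ) ⊗ₖ C)
  have hU {A : Matrix (Fin a) (Fin a) ℂ} (h : A.IsHermitian) : star (U A) = U A := by
    simp [U, star_eq_conjTranspose, conjTranspose_kronecker, h.eq]
  have hV {B : Matrix (Fin b) (Fin b) ℂ} (h : B.IsHermitian) : star (V B) = V B := by
    simp [V, star_eq_conjTranspose, conjTranspose_kronecker, h.eq]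
  have hW {C : Matrix (Fin c) (Fin c) ℂ} (h : C.IsHermitian) : star (W C) = W C := by
    simp [W, star_eq_conjTranspose, conjTranspose_kronecker, h.eq]
  have hUn {A : Matrix (Fin a) (Fin a) ℂ} (h : (1 - A * A).PosSemidef) :
      (1 - U A * U A).PosSemidef := by
    simpa [U, ← mul_kronecker_mul, sub_kronecker]
      using h.kronecker ((PosSemidef.one (n := Fin b) (R := ℂ)).kronecker
      (PosSemidef.one (n := Fin c) (R := ℂ)))
  have hVn {B : Matrix (Fin b) (Fin b) ℂ} (h : (1 - B * B).PosSemidef) :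
      (1 - V B * V B).PosSemidef := by
    simpa [V, ← mul_kronecker_mul, sub_kronecker, kronecker_sub]
      using (PosSemidef.one (n := Fin a) (R := ℂ)).kronecker (h.kronecker
      (PosSemidef.one (n := Fin c) (R := ℂ)))
  have hWn {C : Matrix (Fin c) (Fin c) ℂ} (h : (1 - C * C).PosSemidef) :
      (1 - W C * W C).PosSemidef := by
    simpa [W, ← mul_kronecker_mul, kronecker_sub]
      using (PosSemidef.one (n := Fin a) (R := ℂ)).kronecker
      ((PosSemidef.one (n := Fin b) (R := ℂ)).kronecker h)
  have hUV A B : Commute (U A) (V B) := by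
    simp [U, V, commute_iff_eq, ← mul_kronecker_mul]
  have hUW A C : Commute (U A) (W C) := by
    simp [U, W, commute_iff_eq, ← mul_kronecker_mul]
  have hVW B C : Commute (V B) (W C) := by
    simp [V, W, commute_iff_eq, ← mul_kronecker_mul]
  have hAB : A₁ ⊗ₖ ((B₁ + B₂) ⊗ₖ (1 : Matrix (Fin c) (Fin c) ℂ)) +
      A₂ ⊗ₖ ((B₁ - B₂) ⊗ₖ (1 : Matrix (Fin c) (Fin c) ℂ)) =
      U A₁ * (V B₁ + V B₂) + U A₂ * (V B₁ - V B₂) := by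
    simp [U, V, mul_add, mul_sub, ← mul_kronecker_mul, add_kronecker, sub_kronecker,
      kronecker_add, kronecker_sub]
  have hAC : A₁ ⊗ₖ ((1 : Matrix (Fin b) (Fin b) ℂ) ⊗ₖ (C₁ + C₂)) +
      A₂ ⊗ₖ ((1 : Matrix (Fin b) (Fin b) ℂ) ⊗ₖ (C₁ - C₂)) =
      U A₁ * (W C₁ + W C₂) + U A₂ * (W C₁ - W C₂) := by
    simp [U, W, mul_add, mul_sub, ← mul_kronecker_mul, kronecker_add, kronecker_sub]
  have key (x y : ℝ) := posSemidef_sub_chsh_combination_sq x y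
    (hU hA₁) (hU hA₂) (hV hB₁) (hV hB₂) (hW hC₁) (hW hC₂) (hUn hA₁n) (hUn hA₂n) (hVn hB₁n) (hVn hB₂n) (hWn hC₁n) (hWn hC₂n)
    (hUV _ _) (hUV _ _) (hUV _ _) (hUV _ _) (hUW _ _) (hUW _ _) (hUW _ _) (hUW _ _)
    (hVW _ _) (hVW _ _) (hVW _ _) (hVW _ _)
  rw [← hAB, ← hAC] at key
  set P := A₁ ⊗ₖ ((B₁ + B₂) ⊗ₖ (1 : Matrix (Fin c) (Fin c) ℂ)) +
      A₂ ⊗ₖ ((B₁ - B₂) ⊗ₖ (1 : Matrix (Fin c) (Fin c) ℂ))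
  set Q := A₁ ⊗ₖ ((1 : Matrix (Fin b) (Fin b) ℂ) ⊗ₖ (C₁ + C₂)) +
      A₂ ⊗ₖ ((1 : Matrix (Fin b) (Fin b) ℂ) ⊗ₖ (C₁ - C₂))
  have hP : IsSelfAdjoint P := by
    simp only [IsSelfAdjoint, P, star_eq_conjTranspose, conjTranspose_add, conjTranspose_sub,
      conjTranspose_kronecker, conjTranspose_one, hA₁.eq, hA₂.eq, hB₁.eq, hB₂.eq]
  have hQ : IsSelfAdjoint Q := by
    simp only [IsSelfAdjoint, Q, star_eq_conjTranspose, conjTranspose_add, conjTranspose_sub,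
      conjTranspose_kronecker, conjTranspose_one, hA₁.eq, hA₂.eq, hC₁.eq, hC₂.eq]
  set x := (ρ * P).trace.re with hx
  set y := (ρ * Q).trace.re with hy
  have hM : (ρ * (x • P + y • Q)).trace.re = x ^ 2 + y ^ 2 := by
    simp [mul_add, ← hx, ← hy, sq]
  have hself : IsSelfAdjoint (x • P + y • Q) :=
    ((IsSelfAdjoint.all x).smul hP).add ((IsSelfAdjoint.all y).smul hQ)
  have h := hρ.sq_re_trace_mul_le hρtr hself (key x y)
  rw [hM] at h
  nlinarith [sq_nonneg x, sq_nonneg y]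
end

section
/- Let M₁ and M₂ be 2d×2d Hermitian unitary matrices, each with eigenvalues ±1 of multiplicity d. Then there exists a unitary U such that U M₁ U† = ⊕_{j=1}^d Z and U M₂ U† = ⊕_{j=1}^d (cos θ_j · Z + sin θ_j · X) for some angles θ_j, where X and Z are the Pauli matrices. -/
open Matrix

/-- A self-adjoint involution whose eigenvalues `1` and `-1` have the same multiplicity. -/
structure IsBalancedInvolution {V : Type*} [NormedAddCommGroup V] [InnerProductSpace ℂ V]
    (T : V →ₗ[ℂ] V) : Prop where
  isSymmetric : T.IsSymmetric
  apply_apply : ∀ x, T (T x) = x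
  trace_eq_zero : LinearMap.trace ℂ V T = 0

/-- The orthonormal pair `e`, `f` spans a plane on which `T₁` acts as `Z` and `T₂` acts as
`cos θ • Z + sin θ • X`. -/
structure IsCanonicalPair {V : Type*} [NormedAddCommGroup V] [InnerProductSpace ℂ V]
    (T₁ T₂ : V →ₗ[ℂ] V) (θ : ℝ) (e f : V) : Prop where
  fst_left : T₁ e = e
  fst_right : T₁ f = -f
  snd_left : T₂ e = (Real.cos θ : ℂ) • e + (Real.sin θ : ℂ) • f
  snd_right : T₂ f = (Real.sin θ : ℂ) • e - (Real.cos θ : ℂ) • f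

section

variable {V : Type*} [NormedAddCommGroup V] [InnerProductSpace ℂ V]

theorem IsBalancedInvolution.neg {T : V →ₗ[ℂ] V} (hT : IsBalancedInvolution T) :
    IsBalancedInvolution (-T) where
  isSymmetric x y := by simp [hT.isSymmetric x y]
  apply_apply x := by simp [hT.apply_apply]
  trace_eq_zero := by simp [hT.trace_eq_zero]

theorem LinearMap.IsSymmetric.inner_eq_zero_of_apply_eq {T : V →ₗ[ℂ] V} (hT : T.IsSymmetric)
    {e f : V} (he : T e = e) (hf : T f = -f) : inner ℂ e f = 0 := by
  have h := hT e f
  rw [he, hf, inner_neg_right] at h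
  exact self_eq_neg.mp h

/-- A vector orthogonal to the `1`-eigenspace of a self-adjoint involution is in its
`-1`-eigenspace. -/
theorem IsBalancedInvolution.apply_eq_neg {T : V →ₗ[ℂ] V} (hT : IsBalancedInvolution T)
    {x : V} (hx : ∀ y, T y = y → inner ℂ y x = 0) : T x = -x := by
  have h1 : T (x + T x) = x + T x := by rw [map_add, hT.apply_apply, add_comm]
  have h2 := hx _ h1
  have h3 : inner ℂ (x + T x) (T x) = 0 := by rw [← hT.isSymmetric, h1, h2]
  have h4 : inner ℂ (x + T x) (x + T x) = 0 := by rw [inner_add_right, h2, h3, add_zero]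
  exact (neg_eq_of_add_eq_zero_right (inner_self_eq_zero.mp h4)).symm

variable [FiniteDimensional ℂ V]

theorem IsBalancedInvolution.two_mul_finrank_eqLocus {T : V →ₗ[ℂ] V}
    (hT : IsBalancedInvolution T) :
    2 * Module.finrank ℂ (LinearMap.eqLocus T LinearMap.id) = Module.finrank ℂ V := by
  have hP : LinearMap.IsProj (LinearMap.eqLocus T LinearMap.id)
      ((2⁻¹ : ℂ) • (LinearMap.id + T)) := by
    constructor
    · intro x
      simp [LinearMap.mem_eqLocus, hT.apply_apply, add_comm]
    · intro x hx
      have hx' : T x = x := hx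
      simp only [LinearMap.smul_apply, LinearMap.add_apply, LinearMap.id_apply, hx']
      rw [← two_smul ℂ x, smul_smul]
      norm_num
  have h := hP.trace
  rw [map_smul, map_add, hT.trace_eq_zero, LinearMap.trace_id, add_zero, smul_eq_mul] at h
  have h' : (2 : ℂ) * Module.finrank ℂ (LinearMap.eqLocus T LinearMap.id)
      = Module.finrank ℂ V := by
    rw [← h]; ring
  exact_mod_cast h'

/-- If two balanced involutions have a common fixed vector, they have a common
anti-fixed unit vector. -/
theorem IsBalancedInvolution.exists_common_neg {T₁ T₂ : V →ₗ[ℂ] V}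
    (h₁ : IsBalancedInvolution T₁) (h₂ : IsBalancedInvolution T₂)
    {u : V} (hu : u ≠ 0) (hu₁ : T₁ u = u) (hu₂ : T₂ u = u) :
    ∃ x : V, ‖x‖ = 1 ∧ T₁ x = -x ∧ T₂ x = -x := by
  set E₁ := LinearMap.eqLocus T₁ LinearMap.id
  set E₂ := LinearMap.eqLocus T₂ LinearMap.id
  have hinf : E₁ ⊓ E₂ ≠ ⊥ := fun h ↦ hu ((Submodule.eq_bot_iff _).mp h u ⟨hu₁, hu₂⟩)
  have hpos : 0 < Module.finrank ℂ ↥(E₁ ⊓ E₂) :=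
    Nat.pos_of_ne_zero fun h ↦ hinf (Submodule.finrank_eq_zero.mp h)
  have hsum := Submodule.finrank_sup_add_finrank_inf_eq E₁ E₂
  have hd₁ : 2 * Module.finrank ℂ E₁ = _ := h₁.two_mul_finrank_eqLocus
  have hd₂ : 2 * Module.finrank ℂ E₂ = _ := h₂.two_mul_finrank_eqLocus
  have hne : (E₁ ⊔ E₂)ᗮ ≠ ⊥ := by
    intro h
    rw [Submodule.orthogonal_eq_bot_iff] at h
    rw [h, finrank_top] at hsum
    omega
  obtain ⟨x, hx, hx0⟩ := Submodule.exists_mem_ne_zero_of_ne_bot hne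
  have hx₁ : T₁ x = -x := h₁.apply_eq_neg fun y hy ↦ hx y (Submodule.mem_sup_left hy)
  have hx₂ : T₂ x = -x := h₂.apply_eq_neg fun y hy ↦ hx y (Submodule.mem_sup_right hy)
  exact ⟨((‖x‖ : ℂ)⁻¹) • x, norm_smul_inv_norm hx0, by simp [hx₁], by simp [hx₂]⟩

/-- The compression of `T₂` to the fixed space of `T₁` has an eigenvector. -/
theorem IsBalancedInvolution.exists_compression_eigenvector [Nontrivial V] {T₁ T₂ : V →ₗ[ℂ] V}
    (h₁ : IsBalancedInvolution T₁) (h₂ : IsBalancedInvolution T₂) :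
    ∃ (e : V) (c : ℝ), ‖e‖ = 1 ∧ T₁ e = e ∧ T₁ (T₂ e - (c : ℂ) • e) = -(T₂ e - (c : ℂ) • e) := by
  set E := LinearMap.eqLocus T₁ LinearMap.id
  have hd : 2 * Module.finrank ℂ E = _ := h₁.two_mul_finrank_eqLocus
  have hV : 0 < Module.finrank ℂ V := Module.finrank_pos
  have : Nontrivial E := Module.nontrivial_of_finrank_pos (R := ℂ) (by omega)
  set K : V →ₗ[ℂ] V := T₂ + T₁ ∘ₗ T₂ ∘ₗ T₁
  have hK : K.IsSymmetric := fun x y ↦ by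
    simp only [K, LinearMap.add_apply, LinearMap.comp_apply, inner_add_left, inner_add_right,
      h₁.isSymmetric _ _, h₂.isSymmetric _ _]
  have hKE : ∀ x ∈ E, K x ∈ E := fun x hx ↦ by
    have hx' : T₁ x = x := hx
    simp [E, K, LinearMap.mem_eqLocus, hx', h₁.apply_apply, add_comm]
  have hKr := hK.restrict_invariant hKE
  obtain ⟨μ, hμ⟩ := Module.End.exists_eigenvalue (K.restrict hKE)
  have hreal := hKr.conj_eigenvalue_eq_self hμ
  obtain ⟨v, hv⟩ := hμ.exists_hasEigenvector
  have hv0 : (v : V) ≠ 0 := fun h ↦ hv.2 (Subtype.ext h)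
  have hv₁ : T₁ v = v := v.2
  have hKv : T₂ v + T₁ (T₂ v) = μ • (v : V) := by
    have h := congrArg Subtype.val hv.apply_eq_smul
    simpa [K, hv₁] using h
  have hμre : ((μ.re : ℝ) : ℂ) = μ := Complex.conj_eq_iff_re.mp hreal
  refine ⟨((‖(v : V)‖ : ℂ)⁻¹) • (v : V), μ.re / 2, norm_smul_inv_norm hv0, by simp [hv₁], ?_⟩
  have h : T₁ (T₂ v) = μ • (v : V) - T₂ v := eq_sub_of_add_eq' hKv
  simp only [map_sub, map_smul, hv₁, h]
  push_cast
  rw [hμre]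
  module

/-- Two balanced involutions have a common invariant plane on which they are in canonical form. -/
theorem IsBalancedInvolution.exists_isCanonicalPair [Nontrivial V] {T₁ T₂ : V →ₗ[ℂ] V}
    (h₁ : IsBalancedInvolution T₁) (h₂ : IsBalancedInvolution T₂) :
    ∃ (e f : V) (θ : ℝ), ‖e‖ = 1 ∧ ‖f‖ = 1 ∧ IsCanonicalPair T₁ T₂ θ e f := by
  obtain ⟨e, c, he, he₁, hg₁⟩ := h₁.exists_compression_eigenvector h₂
  have he0 : e ≠ 0 := fun h ↦ by simp [h] at he
  set g := T₂ e - (c : ℂ) • e with hg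
  have hT₂e : T₂ e = (c : ℂ) • e + g := by rw [hg]; abel
  have heg : inner ℂ e g = 0 := h₁.isSymmetric.inner_eq_zero_of_apply_eq he₁ hg₁
  have hnorm : c ^ 2 + ‖g‖ ^ 2 = 1 := by
    have h1 : ‖T₂ e‖ ^ 2 = 1 := by
      rw [← inner_self_eq_norm_sq (𝕜 := ℂ), h₂.isSymmetric, h₂.apply_apply,
        inner_self_eq_norm_sq, he, one_pow]
    have h2 := norm_add_sq_eq_norm_sq_add_norm_sq_of_inner_eq_zero (𝕜 := ℂ) ((c : ℂ) • e) g
      (by rw [inner_smul_left, heg, mul_zero])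
    rw [← hT₂e, norm_smul, he] at h2
    simp only [Complex.norm_real, Real.norm_eq_abs, mul_one, abs_mul_abs_self] at h2
    nlinarith
  have hc : c ^ 2 ≤ 1 := by nlinarith [sq_nonneg ‖g‖]
  have hcos : Real.cos (Real.arccos c) = c :=
    Real.cos_arccos (by nlinarith) (by nlinarith)
  have hsin : Real.sin (Real.arccos c) = ‖g‖ := by
    rw [Real.sin_arccos, ← hnorm, add_sub_cancel_left, Real.sqrt_sq (norm_nonneg g)]
  by_cases hg0 : g = 0
  · have hfin : ∃ f : V, ‖f‖ = 1 ∧ T₁ f = -f ∧ T₂ f = -((c : ℂ) • f) := by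
      have hc1 : c ^ 2 = 1 := by simpa [hg0] using hnorm
      rcases sq_eq_one_iff.mp hc1 with rfl | rfl
      · obtain ⟨x, hx, hx₁, hx₂⟩ :=
          h₁.exists_common_neg h₂ he0 he₁ (by simpa [hg0] using hT₂e)
        exact ⟨x, hx, hx₁, by simpa using hx₂⟩
      · obtain ⟨x, hx, hx₁, hx₂⟩ :=
          h₁.exists_common_neg h₂.neg he0 he₁ (by simp [hT₂e, hg0])
        exact ⟨x, hx, hx₁, by simpa using hx₂⟩
    obtain ⟨f, hf, hf₁, hf₂⟩ := hfin
    refine ⟨e, f, Real.arccos c, he, hf, he₁, hf₁, ?_, ?_⟩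
    · simp [hcos, hsin, hg0, hT₂e]
    · simp [hcos, hsin, hg0, hf₂]
  · have hs : (‖g‖ : ℂ) ≠ 0 := by simpa using hg0
    have hcs : (1 - (c : ℂ) ^ 2) = (‖g‖ : ℂ) ^ 2 := by
      rw [← Complex.ofReal_one, ← hnorm]; push_cast; ring
    have hT₂g : T₂ g = (1 - (c : ℂ) ^ 2) • e - (c : ℂ) • g := by
      rw [hg, map_sub, map_smul, h₂.apply_apply]
      module
    refine ⟨e, ((‖g‖ : ℂ)⁻¹) • g, Real.arccos c, he, norm_smul_inv_norm hg0, he₁, ?_, ?_, ?_⟩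
    · rw [map_smul, hg₁, smul_neg]
    · rw [hcos, hsin, smul_smul, mul_inv_cancel₀ hs, one_smul, hT₂e]
    · rw [hcos, hsin, map_smul, hT₂g, hcs, smul_sub, smul_smul, smul_comm, pow_two,
        inv_mul_cancel_left₀ hs]

/-- An orthonormal pair and an orthonormal basis of its orthogonal complement form an
orthonormal basis. -/
theorem exists_orthonormalBasis_cons {d : ℕ} (hV : Module.finrank ℂ V = 2 * (d + 1))
    (p : Fin 2 → V) (hp : Orthonormal ℂ p)
    (b : OrthonormalBasis (Fin 2 × Fin d) ℂ (Submodule.span ℂ (Set.range p))ᗮ) :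
    ∃ b' : OrthonormalBasis (Fin 2 × Fin (d + 1)) ℂ V,
      (∀ a, b' (a, 0) = p a) ∧ ∀ a j, b' (a, Fin.succ j) = b (a, j) := by
  let v : Fin 2 × Fin (d + 1) → V :=
    fun q ↦ Fin.cons (α := fun _ ↦ V) (p q.1) (fun j ↦ (b (q.1, j) : V)) q.2
  have hpb : ∀ a q, inner ℂ (p a) (b q : V) = 0 := fun a q ↦
    (b q).2 _ (Submodule.subset_span ⟨a, rfl⟩)
  have hbp : ∀ a q, inner ℂ (b q : V) (p a) = 0 := fun a q ↦ inner_eq_zero_symm.mp (hpb a q)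
  have hb : ∀ q r, inner ℂ (b q : V) (b r : V) = if q = r then (1 : ℂ) else 0 := fun q r ↦
    orthonormal_iff_ite.mp b.orthonormal q r
  have hv : Orthonormal ℂ v := by
    rw [orthonormal_iff_ite]
    rintro ⟨a, i⟩ ⟨a', j⟩
    induction i using Fin.cases <;> induction j using Fin.cases <;>
      simp [v, hpb, hbp, hb, orthonormal_iff_ite.mp hp, Fin.succ_ne_zero,
        (Fin.succ_ne_zero _).symm]
  have hcard : Fintype.card (Fin 2 × Fin (d + 1)) = Module.finrank ℂ V := by simp [hV]
  have hspan := hv.linearIndependent.span_eq_top_of_card_eq_finrank' hcard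
  refine ⟨OrthonormalBasis.mk hv hspan.ge, ?_, ?_⟩ <;> intros <;> simp [v]

/-- A balanced involution leaving the orthogonal complement of a plane invariant, and having trace
zero on the plane, restricts to a balanced involution of the complement. -/
theorem IsBalancedInvolution.restrict {d : ℕ} (hV : Module.finrank ℂ V = 2 * (d + 1))
    {T : V →ₗ[ℂ] V} (hT : IsBalancedInvolution T) (p : Fin 2 → V) (hp : Orthonormal ℂ p)
    (htr : ∑ a, inner ℂ (p a) (T (p a)) = 0)
    (hW : Module.finrank ℂ (Submodule.span ℂ (Set.range p))ᗮ = 2 * d)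
    (hinv : ∀ x ∈ (Submodule.span ℂ (Set.range p))ᗮ, T x ∈ (Submodule.span ℂ (Set.range p))ᗮ) :
    IsBalancedInvolution (T.restrict hinv) where
  isSymmetric := hT.isSymmetric.restrict_invariant hinv
  apply_apply x := Subtype.ext (hT.apply_apply x)
  trace_eq_zero := by
    let b : OrthonormalBasis (Fin 2 × Fin d) ℂ (Submodule.span ℂ (Set.range p))ᗮ :=
      (stdOrthonormalBasis ℂ _).reindex (Fintype.equivOfCardEq (by simp [hW]))
    obtain ⟨b', hb0, hbs⟩ := exists_orthonormalBasis_cons hV p hp b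
    have h := hT.trace_eq_zero
    rw [LinearMap.trace_eq_sum_inner T b', Fintype.sum_prod_type] at h
    simp only [Fin.sum_univ_succ (n := d), hb0, hbs, Finset.sum_add_distrib, htr, zero_add] at h
    rw [LinearMap.trace_eq_sum_inner _ b, Fintype.sum_prod_type, ← h]
    rfl

end

/-- Two balanced involutions are simultaneously block diagonal in an orthonormal basis made of
canonical pairs. -/
theorem IsBalancedInvolution.exists_orthonormalBasis {d : ℕ} :
    ∀ {V : Type*} [NormedAddCommGroup V] [InnerProductSpace ℂ V] [FiniteDimensional ℂ V]
      {T₁ T₂ : V →ₗ[ℂ] V}, IsBalancedInvolution T₁ → IsBalancedInvolution T₂ →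
      Module.finrank ℂ V = 2 * d →
      ∃ (b : OrthonormalBasis (Fin 2 × Fin d) ℂ V) (θ : Fin d → ℝ),
        ∀ j, IsCanonicalPair T₁ T₂ (θ j) (b (0, j)) (b (1, j)) := by
  induction d with
  | zero =>
    intro V _ _ _ T₁ T₂ _ _ hV
    exact ⟨(stdOrthonormalBasis ℂ V).reindex (Fintype.equivOfCardEq (by simp [hV])),
      Fin.elim0, fun j ↦ j.elim0⟩
  | succ d ih =>
    intro V _ _ _ T₁ T₂ h₁ h₂ hV
    have : Nontrivial V := Module.nontrivial_of_finrank_pos (R := ℂ) (by omega)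
    obtain ⟨e, f, θ, he, hf, hef⟩ := h₁.exists_isCanonicalPair h₂
    have hin : inner ℂ e f = 0 :=
      h₁.isSymmetric.inner_eq_zero_of_apply_eq hef.fst_left hef.fst_right
    have hin' : inner ℂ f e = 0 := inner_eq_zero_symm.mp hin
    have hp : Orthonormal ℂ ![e, f] := by
      rw [orthonormal_iff_ite]
      intro i j
      fin_cases i <;> fin_cases j <;> simp [hin, hin', he, hf]
    have hW : Module.finrank ℂ (Submodule.span ℂ (Set.range ![e, f]))ᗮ = 2 * d := by
      have h := (Submodule.span ℂ (Set.range ![e, f])).finrank_add_finrank_orthogonal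
      rw [finrank_span_eq_card hp.linearIndependent, hV, Fintype.card_fin] at h
      omega
    have hmem : ∀ x, x ∈ (Submodule.span ℂ (Set.range ![e, f]))ᗮ ↔
        inner ℂ e x = 0 ∧ inner ℂ f x = 0 := by
      intro x
      simp [Submodule.span_insert, ← Submodule.inf_orthogonal,
        Submodule.mem_orthogonal_singleton_iff_inner_right, and_comm]
    have hinv₁ : ∀ x ∈ (Submodule.span ℂ (Set.range ![e, f]))ᗮ,
        T₁ x ∈ (Submodule.span ℂ (Set.range ![e, f]))ᗮ := by
      intro x hx
      obtain ⟨hex, hfx⟩ := (hmem x).mp hx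
      rw [hmem, ← h₁.isSymmetric, ← h₁.isSymmetric, hef.fst_left, hef.fst_right]
      simp [hex, hfx]
    have hinv₂ : ∀ x ∈ (Submodule.span ℂ (Set.range ![e, f]))ᗮ,
        T₂ x ∈ (Submodule.span ℂ (Set.range ![e, f]))ᗮ := by
      intro x hx
      obtain ⟨hex, hfx⟩ := (hmem x).mp hx
      rw [hmem, ← h₂.isSymmetric, ← h₂.isSymmetric, hef.snd_left, hef.snd_right]
      simp [inner_add_left, inner_sub_left, inner_smul_left, hex, hfx]
    have hr₁ := h₁.restrict hV _ hp (by simp [hef.fst_left, hef.fst_right, he, hf]) hW hinv₁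
    have hr₂ := h₂.restrict hV _ hp (by
      simp [hef.snd_left, hef.snd_right, hin, hin', he, hf]) hW hinv₂
    obtain ⟨b, φ, hb⟩ := ih hr₁ hr₂ hW
    obtain ⟨b', hb0, hbs⟩ := exists_orthonormalBasis_cons hV _ hp b
    refine ⟨b', Fin.cons θ φ, fun j ↦ ?_⟩
    induction j using Fin.cases with
    | zero => simpa [hb0] using hef
    | succ j =>
      rw [hbs, hbs, Fin.cons_succ]
      exact ⟨congrArg Subtype.val (hb j).fst_left, congrArg Subtype.val (hb j).fst_right,
        congrArg Subtype.val (hb j).snd_left, congrArg Subtype.val (hb j).snd_right⟩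

theorem Matrix.IsHermitian.isBalancedInvolution {n : Type*} [Fintype n] [DecidableEq n]
    {M : Matrix n n ℂ} (hM : M.IsHermitian) (hMM : M * M = 1) (htr : M.trace = 0) :
    IsBalancedInvolution M.toEuclideanLin where
  isSymmetric := isSymmetric_toEuclideanLin_iff.mpr hM
  apply_apply x := by
    rw [← LinearMap.comp_apply, ← toLpLin_mul_same, hMM, toLpLin_one, LinearMap.id_apply]
  trace_eq_zero := by
    rw [toEuclideanLin_eq_toLin_orthonormal, Matrix.trace_toLin_eq, htr]

/-- The matrix whose columns are the vectors of an orthonormal basis is unitary. -/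
theorem OrthonormalBasis.of_mem_unitaryGroup {n : Type*} [Fintype n] [DecidableEq n]
    (b : OrthonormalBasis n ℂ (EuclideanSpace ℂ n)) :
    Matrix.of (fun i j ↦ b j i) ∈ Matrix.unitaryGroup n ℂ := by
  rw [Matrix.mem_unitaryGroup_iff']
  ext i j
  have h := orthonormal_iff_ite.mp b.orthonormal i j
  simpa [Matrix.mul_apply, Matrix.one_apply, PiLp.inner_apply, mul_comm] using h

/-- Canonical form for a pair of ±1-valued projective observables:
two Hermitian unitaries on ℂ^{2d}, each with eigenvalues ±1 of multiplicity d
(equivalently: Hermitian, squaring to the identity, and traceless), can be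
simultaneously brought to a direct sum of 2×2 blocks, with the first equal to
Z on each block and the second equal to cos θⱼ Z + sin θⱼ X. -/
theorem canonical_form_two_observables {d : ℕ}
    (M₁ M₂ : Matrix (Fin 2 × Fin d) (Fin 2 × Fin d) ℂ)
    (hM₁ : M₁.IsHermitian) (hM₂ : M₂.IsHermitian)
    (hM₁u : M₁ * M₁ = 1) (hM₂u : M₂ * M₂ = 1)
    (hM₁t : M₁.trace = 0) (hM₂t : M₂.trace = 0) :
    ∃ U ∈ Matrix.unitaryGroup (Fin 2 × Fin d) ℂ, ∃ θ : Fin d → ℝ,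
      U * M₁ * star U =
        Matrix.blockDiagonal (fun _ : Fin d => (!![1, 0; 0, -1] : Matrix (Fin 2) (Fin 2) ℂ)) ∧
      U * M₂ * star U =
        Matrix.blockDiagonal (fun j : Fin d =>
          (Real.cos (θ j) : ℂ) • (!![1, 0; 0, -1] : Matrix (Fin 2) (Fin 2) ℂ) +
          (Real.sin (θ j) : ℂ) • (!![0, 1; 1, 0] : Matrix (Fin 2) (Fin 2) ℂ)) := by
  obtain ⟨b, θ, hb⟩ := (hM₁.isBalancedInvolution hM₁u hM₁t).exists_orthonormalBasis (d := d)
    (hM₂.isBalancedInvolution hM₂u hM₂t) (by simp)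
  have hV := b.of_mem_unitaryGroup
  set W := Matrix.of (fun i j ↦ b j i) with hW
  have hWW : star W * W = 1 := Matrix.mem_unitaryGroup_iff'.mp hV
  have conj_eq : ∀ M D : Matrix (Fin 2 × Fin d) (Fin 2 × Fin d) ℂ,
      M * W = W * D → star W * M * star (star W) = D := fun M D h ↦ by
    rw [star_star, mul_assoc, h, ← mul_assoc, hWW, one_mul]
  have mul_W : ∀ (M : Matrix (Fin 2 × Fin d) (Fin 2 × Fin d) ℂ) i j,
      (M * W) i j = M.toEuclideanLin (b j) i := fun M i j ↦ rfl
  refine ⟨star W, Unitary.star_mem hV, θ, conj_eq _ _ ?_, conj_eq _ _ ?_⟩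
  · ext i ⟨a, j⟩
    rw [mul_W, Matrix.mul_apply, Fintype.sum_prod_type]
    fin_cases a
    · simp [(hb j).fst_left, blockDiagonal_apply, hW]
    · simp [(hb j).fst_right, blockDiagonal_apply, hW]
  · ext i ⟨a, j⟩
    rw [mul_W, Matrix.mul_apply, Fintype.sum_prod_type]
    fin_cases a
    · simp [(hb j).snd_left, blockDiagonal_apply, hW, mul_comm]
    · simp [(hb j).snd_right, blockDiagonal_apply, hW, mul_comm, sub_eq_add_neg]
end
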